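/- Let V be a finite-dimensional complex vector space with dim_ℂ V = n ≥ 1, and let W be a finite subgroup of GL(V). Call an element w ∈ W a reflection if w ≠ 1 and dim_ℂ ker(w − id) = n − 1; let R ⊆ W be the (finite) set of reflections of W and let A = { ker(w − id) : w ∈ R } be the (finite) set of reflecting hyperplanes. Assume W is generated by R. Let σ : ℂ → ℂ be any ring homomorphism and let 0 ≤ k ≤ n. Then n · Σ_{r ∈ R} ( binom(n,k) − σ( trace(⋀^k r) ) ) = k · binom(n,k) · (|R| + |A|), where ⋀^k r denotes the induced endomorphism of the k-th exterior power ⋀^k_ℂ V. -/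

import Mathlib

/-- The algebra map induced by `g` maps the `k`-th exterior power into itself. -/
theorem exteriorPower_map_mem {R M : Type*} [CommRing R] [AddCommGroup M] [Module R M]
    (k : ℕ) (g : M →ₗ[R] M) {x : ExteriorAlgebra R M} (hx : x ∈ ⋀[R]^k M) :
    ExteriorAlgebra.map g x ∈ ⋀[R]^k M := by
  have hle : Submodule.map (ExteriorAlgebra.map g).toLinearMap
      (LinearMap.range (ExteriorAlgebra.ι R (M := M))) ≤
      LinearMap.range (ExteriorAlgebra.ι R (M := M)) := by
    rintro _ ⟨_, ⟨m, rfl⟩, rfl⟩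
    exact ⟨g m, (ExteriorAlgebra.map_apply_ι g m).symm⟩
  have h : Submodule.map (ExteriorAlgebra.map g).toLinearMap (⋀[R]^k M) ≤ ⋀[R]^k M := by
    show Submodule.map (ExteriorAlgebra.map g).toLinearMap
        (LinearMap.range (ExteriorAlgebra.ι R (M := M)) ^ k) ≤
      LinearMap.range (ExteriorAlgebra.ι R (M := M)) ^ k
    rw [Submodule.map_pow]
    exact pow_le_pow_left' hle k
  exact h ⟨x, hx, rfl⟩

/-- The endomorphism of the `k`-th exterior power `⋀[R]^k M` induced functorially by an
endomorphism `g` of `M` (sending `v₁ ∧ ⋯ ∧ v_k` to `g v₁ ∧ ⋯ ∧ g v_k`). -/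
noncomputable def exteriorPowerMap (R : Type*) {M : Type*} [CommRing R] [AddCommGroup M]
    [Module R M] (k : ℕ) (g : M →ₗ[R] M) : ⋀[R]^k M →ₗ[R] ⋀[R]^k M :=
  (ExteriorAlgebra.map g).toLinearMap.restrict fun _ hx => exteriorPower_map_mem k g hx

open Module in
/-- Trace of the exterior power of a diagonal endomorphism. -/
theorem aux_trace_ext {V : Type*} [AddCommGroup V] [Module ℂ V] {n : ℕ}
    (b : Basis (Fin n) ℂ V) (g : V →ₗ[ℂ] V) (c : Fin n → ℂ) (hg : ∀ i, g (b i) = c i • b i)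
    (k : ℕ) :
    LinearMap.trace ℂ (⋀[ℂ]^k V) (exteriorPowerMap ℂ k g) =
      ∑ S ∈ Finset.powersetCard k (Finset.univ : Finset (Fin n)), ∏ i ∈ S, c i := by
  classical
  have key : ∀ s : Set.powersetCard (Fin n) k, exteriorPowerMap ℂ k g (b.exteriorPower k s) =
      (∏ i ∈ (s : Finset (Fin n)), c i) • b.exteriorPower k s := by
    intro s
    rw [exteriorPower.basis_apply]
    apply Subtype.ext
    change ExteriorAlgebra.map g (ExteriorAlgebra.ιMulti ℂ k _) = _
    rw [ExteriorAlgebra.map_apply_ιMulti]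
    have h1 : (g ∘ (b ∘ (Set.powersetCard.ofFinEmbEquiv.symm s))) =
        fun j => c (Set.powersetCard.ofFinEmbEquiv.symm s j) •
          b (Set.powersetCard.ofFinEmbEquiv.symm s j) := by
      funext j; simp [hg]
    rw [h1]
    have h2 := AlternatingMap.map_smul_univ (ExteriorAlgebra.ιMulti ℂ k (M := V))
      (fun j => c (Set.powersetCard.ofFinEmbEquiv.symm s j))
      (fun j => b (Set.powersetCard.ofFinEmbEquiv.symm s j))
    rw [h2]
    have h3 : ∏ i ∈ (s : Finset (Fin n)), c i =
        ∏ j, c (Set.powersetCard.ofFinEmbEquiv.symm s j) := by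
      have : (s : Finset (Fin n)) =
          Finset.univ.map (Set.powersetCard.ofFinEmbEquiv.symm s).toEmbedding := by
        ext i
        have := Set.powersetCard.mem_range_ofFinEmbEquiv_symm_iff_mem s i
        simp only [Set.mem_range] at this
        simp [this, Set.powersetCard.mem_coe_iff]
      conv_lhs => rw [this]
      rw [Finset.prod_map]
      rfl
    rw [h3]
    rfl
  rw [LinearMap.trace_eq_matrix_trace ℂ (b.exteriorPower k), Matrix.trace]
  have h4 : ∀ s : Set.powersetCard (Fin n) k,
      (LinearMap.toMatrix (b.exteriorPower k) (b.exteriorPower k) (exteriorPowerMap ℂ k g)).diag s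
        = ∏ i ∈ (s : Finset (Fin n)), c i := by
    intro s
    rw [Matrix.diag_apply, LinearMap.toMatrix_apply, key]
    simp
  rw [Finset.sum_congr rfl (fun s _ => h4 s)]
  symm
  apply Finset.sum_subtype
  intro S
  simp [Set.powersetCard.mem_iff]

theorem aux_count (m k : ℕ) (hk : k ≤ m + 1) (ζ : ℂ) :
    ((m + 1 : ℕ) : ℂ) * (((m + 1).choose k : ℂ) -
      ∑ S ∈ Finset.powersetCard k (Finset.univ : Finset (Fin (m + 1))),
        ∏ i ∈ S, (if i = 0 then ζ else 1)) = k * ((m + 1).choose k : ℂ) * (1 - ζ) := by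
  have h1 : ∀ S : Finset (Fin (m + 1)), ∏ i ∈ S, (if i = 0 then ζ else 1) =
      ζ + (1 - ζ) * (if (0 : Fin (m + 1)) ∉ S then 1 else 0) := by
    intro S
    rw [Finset.prod_ite_eq' S 0 (fun _ => ζ)]
    split_ifs <;> simp_all
  have h2 : (Finset.powersetCard k (Finset.univ : Finset (Fin (m + 1)))).filter
      (fun S => (0 : Fin (m + 1)) ∉ S) =
      Finset.powersetCard k ((Finset.univ : Finset (Fin (m + 1))).erase 0) := by
    ext S
    simp only [Finset.mem_filter, Finset.mem_powersetCard, Finset.subset_erase]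
    tauto
  simp_rw [h1]
  rw [Finset.sum_add_distrib, ← Finset.mul_sum, Finset.sum_boole, h2]
  simp only [Finset.card_powersetCard, Finset.sum_const, Finset.card_univ, Fintype.card_fin,
    Finset.card_erase_of_mem (Finset.mem_univ _), Nat.add_sub_cancel, nsmul_eq_mul]
  have h3 := congrArg (Nat.cast : ℕ → ℂ) (Nat.choose_mul_succ_eq m k)
  push_cast [Nat.cast_sub hk] at h3 ⊢
  linear_combination (-(1 - ζ)) * h3

open Module in
/-- A finite-order reflection is diagonalizable. -/
theorem aux_basis {V : Type*} [AddCommGroup V] [Module ℂ V] [FiniteDimensional ℂ V] {m : ℕ}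
    (hn : finrank ℂ V = m + 1) (g : Module.End ℂ V) (N : ℕ) (hN : 0 < N) (hgN : g ^ N = 1)
    (hg : g ≠ 1) (hker : finrank ℂ (LinearMap.ker (g - LinearMap.id)) = m) :
    ∃ (b : Basis (Fin (m + 1)) ℂ V) (ζ : ℂ), ζ ≠ 1 ∧
      ∀ i, g (b i) = (if i = 0 then ζ else 1) • b i := by
  have hr : finrank ℂ (LinearMap.range (g - LinearMap.id)) = 1 := by
    have := (g - LinearMap.id).finrank_range_add_finrank_ker
    omega
  obtain ⟨⟨v, hv⟩, hv0, hspan⟩ := finrank_eq_one_iff'.1 hr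
  have hv0' : v ≠ 0 := fun h => hv0 (Subtype.ext h)
  have hx : ∀ x, ∃ a : ℂ, g x = x + a • v := by
    intro x
    obtain ⟨a, ha⟩ := hspan ⟨(g - LinearMap.id : Module.End ℂ V) x, ⟨x, rfl⟩⟩
    refine ⟨a, ?_⟩
    have : a • v = g x - x := congrArg Subtype.val ha
    rw [this]; abel
  obtain ⟨a, ha⟩ := hx v
  have hmem : ∀ x, x ∈ LinearMap.ker (g - LinearMap.id) ↔ g x = x := by
    intro x
    simp [LinearMap.mem_ker, sub_eq_zero]
  have ha0 : a ≠ 0 := by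
    rintro rfl
    have hgv : g v = v := by simpa using ha
    apply hg
    ext x
    obtain ⟨c, hc⟩ := hx x
    have hp : ∀ j : ℕ, (g ^ j) x = x + ((j : ℂ) * c) • v := by
      intro j
      induction j with
      | zero => simp
      | succ j ih =>
        rw [pow_succ', Module.End.mul_apply, ih, map_add, map_smul, hgv, hc]
        push_cast
        module
    have h := hp N
    rw [hgN] at h
    have h0 : ((N : ℂ) * c) • v = 0 := by simpa using h
    have hNc : (N : ℂ) ≠ 0 := by exact_mod_cast hN.ne'
    have : c = 0 := by
      rcases smul_eq_zero.1 h0 with h | h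
      · exact (mul_eq_zero.1 h).resolve_left hNc
      · exact absurd h hv0'
    simp [hc, this]
  let b0 := finBasisOfFinrankEq ℂ (LinearMap.ker (g - LinearMap.id)) hker
  refine ⟨Basis.mkFinCons v b0 ?_ ?_, 1 + a, by simpa using ha0, ?_⟩
  · intro c x hxm h
    rw [hmem] at hxm
    have h2 := congrArg g h
    rw [map_add, map_smul, hxm, ha, map_zero] at h2
    have h3 : (c * a) • v = 0 := by
      have : (c * a) • v = (c • (v + a • v) + x) - (c • v + x) := by module
      rw [this, h, h2, sub_zero]
    rcases smul_eq_zero.1 h3 with h | h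
    · exact (mul_eq_zero.1 h).resolve_right ha0
    · exact absurd h hv0'
  · intro z
    obtain ⟨c, hc⟩ := hx z
    refine ⟨-(c / a), ?_⟩
    rw [hmem, map_add, map_smul, ha, hc]
    have : (-(c / a)) * a = -c := by field_simp
    rw [smul_add, smul_smul, this]
    module
  · intro i
    rw [Basis.coe_mkFinCons]
    refine Fin.cases ?_ (fun j => ?_) i
    · simp [ha, add_smul]
    · have := (hmem _).1 (b0 j).2
      simp [this, Fin.succ_ne_zero]

open Module in
theorem aux_det {V : Type*} [AddCommGroup V] [Module ℂ V] {m : ℕ}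
    (b : Basis (Fin (m + 1)) ℂ V) (g : Module.End ℂ V) (ζ : ℂ)
    (h : ∀ i, g (b i) = (if i = 0 then ζ else 1) • b i) : LinearMap.det g = ζ := by
  rw [← LinearMap.det_toMatrix b]
  have : LinearMap.toMatrix b b g = Matrix.diagonal (fun i => if i = 0 then ζ else 1) := by
    ext i j
    rw [LinearMap.toMatrix_apply, h, map_smul, Finsupp.smul_apply, Module.Basis.repr_self,
      Finsupp.single_apply, Matrix.diagonal_apply, smul_eq_mul]
    by_cases hij : i = j
    · subst hij; simp
    · rw [if_neg (Ne.symm hij), if_neg hij, mul_zero]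
  rw [this, Matrix.det_diagonal]
  simp

/-- If `W` is a finite subgroup of `GL(V)` (with `dim V = n ≥ 1`) generated by its set `R`
of reflections, with set `A` of reflecting hyperplanes, then for any ring homomorphism
`σ : ℂ → ℂ` and `0 ≤ k ≤ n`:
`n · Σ_{r ∈ R} (binom(n,k) − σ(trace(⋀^k r))) = k · binom(n,k) · (|R| + |A|)`. -/
theorem generalized_coxeter_number {V : Type*} [AddCommGroup V] [Module ℂ V]
    [FiniteDimensional ℂ V] {n : ℕ} (hn : Module.finrank ℂ V = n) (hn1 : 1 ≤ n)
    (W : Subgroup (LinearMap.GeneralLinearGroup ℂ V)) (hWfin : Set.Finite (W : Set (LinearMap.GeneralLinearGroup ℂ V)))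
    (R : Finset (LinearMap.GeneralLinearGroup ℂ V))
    (hR : ∀ w, w ∈ R ↔ w ∈ W ∧ w ≠ 1 ∧
      Module.finrank ℂ (LinearMap.ker ((w : Module.End ℂ V) - LinearMap.id)) = n - 1)
    (A : Finset (Submodule ℂ V))
    (hA : ∀ Hyp, Hyp ∈ A ↔ ∃ w ∈ R,
      Hyp = LinearMap.ker ((w : Module.End ℂ V) - LinearMap.id))
    (hgen : Subgroup.closure (R : Set (LinearMap.GeneralLinearGroup ℂ V)) = W)
    (σ : ℂ →+* ℂ) (k : ℕ) (hk : k ≤ n) :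
    (n : ℂ) * ∑ r ∈ R, ((n.choose k : ℂ) -
        σ (LinearMap.trace ℂ (⋀[ℂ]^k V) (exteriorPowerMap ℂ k (r : Module.End ℂ V)))) =
      (k : ℂ) * (n.choose k : ℂ) * ((R.card : ℂ) + (A.card : ℂ)) := by
  classical
  obtain ⟨m, rfl⟩ : ∃ m, n = m + 1 := ⟨n - 1, by omega⟩
  simp only [Nat.add_sub_cancel] at hR
  have hfin : Finite W := hWfin
  -- each reflection is diagonalizable
  have hdiag : ∀ r ∈ R, ∃ (b : Module.Basis (Fin (m + 1)) ℂ V) (ζ : ℂ), ζ ≠ 1 ∧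
      ∀ i, (r : Module.End ℂ V) (b i) = (if i = 0 then ζ else 1) • b i := by
    intro r hr
    obtain ⟨hrW, hr1, hrk⟩ := (hR r).1 hr
    have hpow : r ^ Nat.card W = 1 := by
      have := pow_card_eq_one' (x := (⟨r, hrW⟩ : W))
      exact congrArg Subtype.val this
    refine aux_basis hn _ (Nat.card W) Nat.card_pos ?_ ?_ hrk
    · rw [← Units.val_pow_eq_pow_val, hpow, Units.val_one]
    · intro h
      exact hr1 (Units.ext h)
  let χ : LinearMap.GeneralLinearGroup ℂ V → ℂ := fun w => σ (LinearMap.det (w : Module.End ℂ V))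
  have hχmul : ∀ a b, χ (a * b) = χ a * χ b := by
    intro a b; simp [χ]
  have hχ1 : χ 1 = 1 := by simp [χ]
  have hχne : ∀ r ∈ R, χ r ≠ 1 := by
    intro r hr h
    obtain ⟨b, ζ, hζ, hb⟩ := hdiag r hr
    apply hζ
    rw [← aux_det b _ ζ hb]
    exact σ.injective (by rw [map_one]; exact h)
  have hterm : ∀ r ∈ R, ((m + 1 : ℕ) : ℂ) * (((m + 1).choose k : ℂ) -
        σ (LinearMap.trace ℂ (⋀[ℂ]^k V) (exteriorPowerMap ℂ k (r : Module.End ℂ V)))) =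
        k * ((m + 1).choose k : ℂ) * (1 - χ r) := by
    intro r hr
    obtain ⟨b, ζ, hζ, hb⟩ := hdiag r hr
    have h := congrArg σ (aux_count m k hk ζ)
    have hd : χ r = σ ζ := by simp only [χ]; rw [aux_det b _ ζ hb]
    rw [aux_trace_ext b _ _ hb k, hd]
    rw [map_mul, map_sub, map_mul, map_mul, map_sub, map_one, map_natCast, map_natCast,
      map_natCast] at h
    exact h
  have hA' : ∀ H ∈ A, ∑ r ∈ R.filter
      (fun r : LinearMap.GeneralLinearGroup ℂ V => LinearMap.ker ((r : Module.End ℂ V) - LinearMap.id) = H), χ r = -1 := by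
    intro H hH
    obtain ⟨r₀, hr₀, rfl⟩ := (hA H).1 hH
    set H := LinearMap.ker ((r₀ : Module.End ℂ V) - LinearMap.id) with hHdef
    have hHr : Module.finrank ℂ H = m := ((hR r₀).1 hr₀).2.2
    have hmemk : ∀ (g : Module.End ℂ V) x, x ∈ LinearMap.ker (g - LinearMap.id) ↔ g x = x := by
      intro g x
      simp [LinearMap.mem_ker, sub_eq_zero]
    set T := R.filter
      (fun r : LinearMap.GeneralLinearGroup ℂ V => LinearMap.ker ((r : Module.End ℂ V) - LinearMap.id) = H) with hT
    have h1T : (1 : LinearMap.GeneralLinearGroup ℂ V) ∉ T := by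
      intro h
      exact ((hR 1).1 (Finset.mem_filter.1 h).1).2.1 rfl
    have hmemT : ∀ w, w ∈ insert 1 T ↔ w ∈ W ∧ ∀ x ∈ H, (w : Module.End ℂ V) x = x := by
      intro w
      rw [Finset.mem_insert, hT, Finset.mem_filter]
      constructor
      · rintro (rfl | ⟨hw, hwH⟩)
        · exact ⟨W.one_mem, fun x _ => by simp⟩
        · refine ⟨((hR w).1 hw).1, fun x hx => ?_⟩
          rw [← hwH] at hx
          exact (hmemk _ _).1 hx
      · rintro ⟨hw, hx⟩
        by_cases h1 : w = 1
        · exact Or.inl h1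
        · right
          have hle : H ≤ LinearMap.ker ((w : Module.End ℂ V) - LinearMap.id) :=
            fun x hxH => (hmemk _ _).2 (hx x hxH)
          have hlt : Module.finrank ℂ (LinearMap.ker ((w : Module.End ℂ V) - LinearMap.id))
              < m + 1 := by
            rw [← hn]
            apply Submodule.finrank_lt
            intro htop
            apply h1
            apply Units.ext
            ext x
            have : x ∈ LinearMap.ker ((w : Module.End ℂ V) - LinearMap.id) := by
              rw [htop]; trivial
            simpa using (hmemk _ _).1 this
          have heq := Submodule.eq_of_le_of_finrank_le hle (by omega)
          exact ⟨(hR w).2 ⟨hw, h1, by rw [← heq, hHr]⟩, heq.symm⟩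
    have hr₀T := (hmemT r₀).1 (Finset.mem_insert_of_mem (Finset.mem_filter.2 ⟨hr₀, rfl⟩))
    have hsum : ∑ w ∈ insert 1 T, χ w = ∑ w ∈ insert 1 T, χ r₀ * χ w := by
      symm
      refine Finset.sum_equiv (Equiv.mulLeft r₀) (fun w => ?_) (fun w _ => ?_)
      · rw [hmemT, hmemT, Equiv.coe_mulLeft, W.mul_mem_cancel_left hr₀T.1]
        refine and_congr_right fun _ => forall₂_congr fun x hx => ?_
        rw [Units.val_mul, Module.End.mul_apply]
        constructor
        · intro h; rw [h, hr₀T.2 x hx]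
        · intro h
          have h2 : (r₀ : Module.End ℂ V) ((w : Module.End ℂ V) x) =
              (r₀ : Module.End ℂ V) x := by rw [h, hr₀T.2 x hx]
          have hinv : ∀ y, ((r₀⁻¹ : LinearMap.GeneralLinearGroup ℂ V) : Module.End ℂ V)
              ((r₀ : Module.End ℂ V) y) = y := by
            intro y
            rw [← Module.End.mul_apply, ← Units.val_mul, inv_mul_cancel]
            rfl
          have h3 := congrArg ((r₀⁻¹ : LinearMap.GeneralLinearGroup ℂ V) : Module.End ℂ V) h2
          rwa [hinv, hinv] at h3
      · rw [Equiv.coe_mulLeft, hχmul]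
    rw [← Finset.mul_sum, Finset.sum_insert h1T, hχ1] at hsum
    have hz : (1 - χ r₀) * (1 + ∑ r ∈ T, χ r) = 0 := by linear_combination hsum
    have hz2 := (mul_eq_zero.1 hz).resolve_left (sub_ne_zero.2 (hχne r₀ hr₀).symm)
    linear_combination hz2
  have htot : ∑ r ∈ R, χ r = -(A.card : ℂ) := by
    rw [← Finset.sum_fiberwise_of_maps_to (t := A)
      (g := fun r : LinearMap.GeneralLinearGroup ℂ V => LinearMap.ker ((r : Module.End ℂ V) - LinearMap.id))
      (fun r hr => (hA _).2 ⟨r, hr, rfl⟩)]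
    rw [Finset.sum_congr rfl hA']
    simp
  rw [Finset.mul_sum, Finset.sum_congr rfl hterm, ← Finset.mul_sum, Finset.sum_sub_distrib, htot]
  simp
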